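/- Let R be a (not necessarily commutative) ring whose underlying additive group is finitely generated, and suppose the group of units R^× is infinite. Then for every integer m ≥ 2 there exists a unit α ∈ R^× with α ≠ 1 and α ≠ −1 such that m divides 1 − α in R, i.e. there exists β ∈ R with 1 − α = m·β. -/

import Mathlib

/-- Modulo `m ≠ 0`, a finitely generated abelian group has only finitely many classes. -/
theorem finite_quotient_range_lsmul (M : Type*) [AddCommGroup M] [AddGroup.FG M]
    {m : ℤ} (hm : m ≠ 0) : Finite (M ⧸ LinearMap.range (LinearMap.lsmul ℤ M m)) := by
  have : Module.Finite ℤ M := Module.Finite.iff_addGroup_fg.mpr inferInstance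
  refine Module.finite_of_fg_torsion _ fun {x} => ?_
  obtain ⟨y, rfl⟩ := Submodule.Quotient.mk_surjective _ x
  refine ⟨⟨m, mem_nonZeroDivisors_of_ne_zero hm⟩, ?_⟩
  exact (Submodule.Quotient.mk_eq_zero _).mpr ⟨y, rfl⟩

/-- Let `R` be a (not necessarily commutative) ring whose underlying
additive group is finitely generated, and suppose the group of units `Rˣ` is infinite.
Then for every integer `m ≥ 2` there exists a unit `α ∈ Rˣ` with `α ≠ 1`, `α ≠ -1`,
and `m ∣ 1 - α` in `R`, i.e. `1 - α = m • β` for some `β ∈ R`. -/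
theorem exists_unit_one_sub_dvd_of_infinite_units
    (R : Type*) [Ring R] [AddGroup.FG R] [Infinite Rˣ]
    (m : ℤ) (hm : 2 ≤ m) :
    ∃ α : Rˣ, (α : R) ≠ 1 ∧ (α : R) ≠ -1 ∧ ∃ β : R, 1 - (α : R) = m • β := by
  have := finite_quotient_range_lsmul R (m := m) (by omega)
  let S := LinearMap.range (LinearMap.lsmul ℤ R m)
  obtain ⟨c, hc⟩ := Finite.exists_infinite_fiber (fun u : Rˣ => S.mkQ (u : R))
  have hinf := Set.infinite_coe_iff.mp hc
  obtain ⟨v, hv⟩ := hinf.nonempty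
  obtain ⟨u, hu, hne⟩ := (hinf.sdiff (Set.toFinite {v, -v})).nonempty
  simp only [Set.mem_insert_iff, Set.mem_singleton_iff, not_or] at hne
  obtain ⟨y, hy⟩ : (v : R) - u ∈ S := (Submodule.Quotient.eq S).mp (hv.trans hu.symm)
  refine ⟨u * v⁻¹, fun h => hne.1 ?_, fun h => hne.2 ?_, y * (v⁻¹ : Rˣ), ?_⟩
  · exact mul_inv_eq_one.mp (Units.ext h)
  · have h' : u * v⁻¹ = -1 := Units.ext (by simpa using h)
    rw [mul_inv_eq_iff_eq_mul] at h'
    simpa using h'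
  · have hy' : m • y = (v : R) - u := hy
    rw [← smul_mul_assoc, hy', sub_mul, Units.mul_inv, Units.val_mul]
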